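/- Let n ≥ 2 be an integer and α ∈ [0,1). Let V be a C^n-solution of the Goursat problem for the Euler–Darboux equation in D with data {V0, V1}, where V0, V1 ∈ C([0,1)) ∩ C^n((0,1)) are real-valued, x^α V0'(x) and y^α V1'(y) extend continuously to [0,1), and V0(0) = V1(0) = 0. Then for every (x,y) ∈ D and every k ∈ ℂ ∖ [0,1], all four integrals below converge absolutely and ∫_0^x λ(x',0,k) V_x(x',0) dx' + ∫_0^y λ(x,y',k)^{-1} V_y(x,y') dy' = ∫_0^y λ(0,y',k)^{-1} V_y(0,y') dy' + ∫_0^x λ(x',y,k) V_x(x',y) dx'. -/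

import Mathlib

open Complex Set MeasureTheory Topology Filter ComplexConjugate

noncomputable section

/-- The triangle `D = {(x,y) : 0 ≤ x, 0 ≤ y, x + y < 1}`. -/
def TriD : Set (ℝ × ℝ) := {p | 0 ≤ p.1 ∧ 0 ≤ p.2 ∧ p.1 + p.2 < 1}

/-- Partial derivative in the first variable. -/
def pdx (f : ℝ → ℝ → ℂ) (x y : ℝ) : ℂ := deriv (fun t => f t y) x

/-- Partial derivative in the second variable. -/
def pdy (f : ℝ → ℝ → ℂ) (x y : ℝ) : ℂ := deriv (fun t => f x t) y

/-- Mixed second partial derivative. -/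
def pdxy (f : ℝ → ℝ → ℂ) (x y : ℝ) : ℂ := pdx (fun a b => pdy f a b) x y

/-- Partial derivative in the first variable (real valued). -/
def pdxR (f : ℝ → ℝ → ℝ) (x y : ℝ) : ℝ := deriv (fun t => f t y) x

/-- Partial derivative in the second variable (real valued). -/
def pdyR (f : ℝ → ℝ → ℝ) (x y : ℝ) : ℝ := deriv (fun t => f x t) y

/-- Mixed second partial derivative (real valued). -/
def pdxyR (f : ℝ → ℝ → ℝ) (x y : ℝ) : ℝ := pdxR (fun a b => pdyR f a b) x y

/-- The hyperbolic Ernst equation at a point. -/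
def ErnstEqAt (E : ℝ → ℝ → ℂ) (x y : ℝ) : Prop :=
  (((E x y).re : ℂ)) * (pdxy E x y - (pdx E x y + pdy E x y) / (2 * (1 - x - y))) =
    pdx E x y * pdy E x y

/-- The Euler–Darboux equation at a point. -/
def EulerDarbouxAt (V : ℝ → ℝ → ℝ) (x y : ℝ) : Prop :=
  pdxyR V x y - (pdxR V x y + pdyR V x y) / (2 * (1 - x - y)) = 0

/-- `λ(x,y,k) = √((k-(1-y))/(k-x))`, principal branch (`Re λ > 0` off the cut). -/
def lam (x y : ℝ) (k : ℂ) : ℂ := ((k - (1 - (y : ℂ))) / (k - (x : ℂ))) ^ (1/2 : ℂ)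

/-- The segment `[0,1]` inside `ℂ`. -/
def seg01 : Set ℂ := (fun t : ℝ => (t : ℂ)) '' Icc 0 1

/-- A `C^n`-solution of the Goursat problem for the hyperbolic Ernst equation in `D`
with data `{E0, E1}`, with regularity exponent `α`. -/
def ErnstSolutionWith (n : ℕ) (α : ℝ) (E : ℝ → ℝ → ℂ) (E0 E1 : ℝ → ℂ) : Prop :=
  ContinuousOn (fun p : ℝ × ℝ => E p.1 p.2) TriD ∧
  ContDiffOn ℝ n (fun p : ℝ × ℝ => E p.1 p.2) (interior TriD) ∧
  (∀ p ∈ interior TriD, ErnstEqAt E p.1 p.2) ∧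
  (∃ g : ℝ × ℝ → ℂ, ContinuousOn g TriD ∧
      ∀ p ∈ interior TriD, g p = ((p.1 ^ α : ℝ) : ℂ) * pdx E p.1 p.2) ∧
  (∃ g : ℝ × ℝ → ℂ, ContinuousOn g TriD ∧
      ∀ p ∈ interior TriD, g p = ((p.2 ^ α : ℝ) : ℂ) * pdy E p.1 p.2) ∧
  (∃ g : ℝ × ℝ → ℂ, ContinuousOn g TriD ∧
      ∀ p ∈ interior TriD, g p = ((p.1 ^ α * p.2 ^ α : ℝ) : ℂ) * pdxy E p.1 p.2) ∧
  (∀ x ∈ Ico (0:ℝ) 1, E x 0 = E0 x) ∧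
  (∀ y ∈ Ico (0:ℝ) 1, E 0 y = E1 y) ∧
  (∀ p ∈ TriD, 0 < (E p.1 p.2).re)

/-- A `C^n`-solution of the Goursat problem for the hyperbolic Ernst equation in `D`
(with regularity exponent `α` existentially quantified over `[0,1)`). -/
def ErnstSolution (n : ℕ) (E : ℝ → ℝ → ℂ) (E0 E1 : ℝ → ℂ) : Prop :=
  ∃ α ∈ Ico (0:ℝ) 1, ErnstSolutionWith n α E E0 E1

/-- A `C^n`-solution of the Goursat problem for the Euler–Darboux equation in `D`
with data `{V0, V1}`, with regularity exponent `α`. -/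
def EDSolutionWith (n : ℕ) (α : ℝ) (V : ℝ → ℝ → ℝ) (V0 V1 : ℝ → ℝ) : Prop :=
  ContinuousOn (fun p : ℝ × ℝ => V p.1 p.2) TriD ∧
  ContDiffOn ℝ n (fun p : ℝ × ℝ => V p.1 p.2) (interior TriD) ∧
  (∀ p ∈ interior TriD, EulerDarbouxAt V p.1 p.2) ∧
  (∃ g : ℝ × ℝ → ℝ, ContinuousOn g TriD ∧
      ∀ p ∈ interior TriD, g p = p.1 ^ α * pdxR V p.1 p.2) ∧
  (∃ g : ℝ × ℝ → ℝ, ContinuousOn g TriD ∧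
      ∀ p ∈ interior TriD, g p = p.2 ^ α * pdyR V p.1 p.2) ∧
  (∃ g : ℝ × ℝ → ℝ, ContinuousOn g TriD ∧
      ∀ p ∈ interior TriD, g p = p.1 ^ α * p.2 ^ α * pdxyR V p.1 p.2) ∧
  (∀ x ∈ Ico (0:ℝ) 1, V x 0 = V0 x) ∧
  (∀ y ∈ Ico (0:ℝ) 1, V 0 y = V1 y)

/-- A `C^n`-solution of the Goursat problem for the Euler–Darboux equation in `D`. -/
def EDSolution (n : ℕ) (V : ℝ → ℝ → ℝ) (V0 V1 : ℝ → ℝ) : Prop :=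
  ∃ α ∈ Ico (0:ℝ) 1, EDSolutionWith n α V V0 V1

/-- The data assumptions (1.5) on a single boundary datum for the Ernst equation. -/
def ErnstData (n : ℕ) (α : ℝ) (E0 : ℝ → ℂ) : Prop :=
  ContinuousOn E0 (Ico 0 1) ∧ ContDiffOn ℝ n E0 (Ioo 0 1) ∧
  (∃ g : ℝ → ℂ, ContinuousOn g (Ico 0 1) ∧
      ∀ x ∈ Ioo (0:ℝ) 1, g x = ((x ^ α : ℝ) : ℂ) * deriv E0 x) ∧
  E0 0 = 1 ∧ (∀ x ∈ Ico (0:ℝ) 1, 0 < (E0 x).re)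

/-- The data assumptions on a single boundary datum for the Euler–Darboux equation. -/
def EDData (n : ℕ) (α : ℝ) (V0 : ℝ → ℝ) : Prop :=
  ContinuousOn V0 (Ico 0 1) ∧ ContDiffOn ℝ n V0 (Ioo 0 1) ∧
  (∃ g : ℝ → ℝ, ContinuousOn g (Ico 0 1) ∧
      ∀ x ∈ Ioo (0:ℝ) 1, g x = x ^ α * deriv V0 x) ∧
  V0 0 = 0

/-- The matrix `U0(x,k)` of the x-part of the Lax pair, built from the boundary datum. -/
def U0mat (E0 : ℝ → ℂ) (x : ℝ) (k : ℂ) : Matrix (Fin 2) (Fin 2) ℂ :=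
  (1 / (2 * ((E0 x).re : ℂ))) •
    !![conj (deriv E0 x), lam x 0 k * conj (deriv E0 x);
       lam x 0 k * deriv E0 x, deriv E0 x]

/-- The matrix `U(x,y,k)` of the Lax pair. -/
def Umat (E : ℝ → ℝ → ℂ) (k : ℂ) (x y : ℝ) : Matrix (Fin 2) (Fin 2) ℂ :=
  (1 / (2 * ((E x y).re : ℂ))) •
    !![conj (pdx E x y), lam x y k * conj (pdx E x y);
       lam x y k * pdx E x y, pdx E x y]

/-- The matrix `V(x,y,k)` of the Lax pair. -/
def Vmat (E : ℝ → ℝ → ℂ) (k : ℂ) (x y : ℝ) : Matrix (Fin 2) (Fin 2) ℂ :=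
  (1 / (2 * ((E x y).re : ℂ))) •
    !![conj (pdy E x y), (lam x y k)⁻¹ * conj (pdy E x y);
       (lam x y k)⁻¹ * pdy E x y, pdy E x y]

lemma mem_interior_triD {s t : ℝ} (hs : 0 < s) (ht : 0 < t) (hst : s + t < 1) :
    (s, t) ∈ interior TriD := by
  have ho : IsOpen {p : ℝ × ℝ | 0 < p.1 ∧ 0 < p.2 ∧ p.1 + p.2 < 1} :=
    (isOpen_lt continuous_const continuous_fst).inter
      ((isOpen_lt continuous_const continuous_snd).inter
        (isOpen_lt (continuous_fst.add continuous_snd) continuous_const))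
  refine interior_maximal (fun p hp => ?_) ho ⟨hs, ht, hst⟩
  exact ⟨hp.1.le, hp.2.1.le, hp.2.2⟩

/-- A continuous weighted extension of a partial derivative to the boundary of the triangle
still computes the partial derivative along the edge `t = 0`. -/
lemma pdxR_eq_rpow_neg_mul {W : ℝ → ℝ → ℝ} {α : ℝ} {g : ℝ × ℝ → ℝ}
    (hW : ContinuousOn (fun p : ℝ × ℝ => W p.1 p.2) TriD)
    (hdiff : ∀ s t, 0 < s → 0 < t → s + t < 1 → DifferentiableAt ℝ (fun a => W a t) s)
    (hg : ContinuousOn g TriD)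
    (hgW : ∀ s t, 0 < s → 0 < t → s + t < 1 → g (s, t) = s ^ α * pdxR W s t)
    {s t : ℝ} (hs : 0 < s) (ht : 0 ≤ t) (hst : s + t < 1) :
    pdxR W s t = s ^ (-α) * g (s, t) := by
  have hint : ∀ s t, 0 < s → 0 < t → s + t < 1 → pdxR W s t = s ^ (-α) * g (s, t) := by
    intro s t hs ht hst
    rw [hgW s t hs ht hst, ← mul_assoc, ← Real.rpow_add hs]
    simp
  rcases ht.lt_or_eq with ht | rfl
  · exact hint s t hs ht hst
  set h : ℝ × ℝ → ℝ := fun p => p.1 ^ (-α) * g p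
  have hcont : Tendsto h (𝓝[TriD] (s, 0)) (𝓝 (h (s, 0))) := by
    refine Tendsto.mul ?_ (hg (s, 0) ⟨hs.le, le_rfl, hst⟩)
    exact (continuousAt_fst.rpow_const (Or.inl hs.ne')).continuousWithinAt
  have hev : ∀ᶠ q : ℝ × ℝ in 𝓝[>] (0 : ℝ) ×ˢ 𝓝 s, 0 < q.1 ∧ 0 < q.2 ∧ q.2 + q.1 < 1 := by
    have h1 : ∀ᶠ r : ℝ in 𝓝[>] (0 : ℝ), 0 < r ∧ r < (1 - s) / 2 := by
      filter_upwards [Ioo_mem_nhdsGT (show (0 : ℝ) < (1 - s) / 2 by linarith)] with r hr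
      exact hr
    have h2 : ∀ᶠ a : ℝ in 𝓝 s, 0 < a ∧ a < s + (1 - s) / 2 :=
      Ioo_mem_nhds hs (by linarith)
    filter_upwards [h1.prod_mk h2] with q hq
    exact ⟨hq.1.1, hq.2.1, by linarith [hq.1.2, hq.2.2]⟩
  have hfst : Tendsto (fun q : ℝ × ℝ => q.1) (𝓝[>] (0 : ℝ) ×ˢ 𝓝 s) (𝓝 0) :=
    tendsto_fst.mono_right nhdsWithin_le_nhds
  have hsnd : Tendsto (fun q : ℝ × ℝ => q.2) (𝓝[>] (0 : ℝ) ×ˢ 𝓝 s) (𝓝 s) := tendsto_snd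
  have key : HasDerivAt (fun a => W a 0) (h (s, 0)) s := by
    refine hasDerivAt_of_tendstoUniformlyOnFilter (l := 𝓝[>] (0 : ℝ))
      (f := fun r a => W a r) (f' := fun r a => h (a, r)) (g' := fun a => h (a, 0)) ?_ ?_ ?_
    · rw [tendstoUniformlyOnFilter_iff_tendsto]
      have t1 : Tendsto (fun q : ℝ × ℝ => h (q.2, 0)) (𝓝[>] (0 : ℝ) ×ˢ 𝓝 s) (𝓝 (h (s, 0))) := by
        refine hcont.comp (tendsto_nhdsWithin_iff.2 ⟨hsnd.prodMk_nhds tendsto_const_nhds, ?_⟩)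
        filter_upwards [hev] with q hq
        exact ⟨hq.2.1.le, le_rfl, by simpa using (by linarith [hq.1, hq.2.2] : q.2 < 1)⟩
      have t2 : Tendsto (fun q : ℝ × ℝ => h (q.2, q.1)) (𝓝[>] (0 : ℝ) ×ˢ 𝓝 s)
          (𝓝 (h (s, 0))) := by
        refine hcont.comp (tendsto_nhdsWithin_iff.2 ⟨hsnd.prodMk_nhds hfst, ?_⟩)
        filter_upwards [hev] with q hq
        exact ⟨hq.2.1.le, hq.1.le, hq.2.2⟩
      exact (t1.prodMk_nhds t2).mono_right (nhds_le_uniformity _)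
    · filter_upwards [hev] with q hq
      have := (hdiff q.2 q.1 hq.2.1 hq.1 hq.2.2).hasDerivAt
      rwa [show deriv (fun a => W a q.1) q.2 = h (q.2, q.1) from
        hint q.2 q.1 hq.2.1 hq.1 hq.2.2] at this
    · filter_upwards [Ioo_mem_nhds hs (show s < 1 by linarith)] with a ha
      have hmem : ((a, 0) : ℝ × ℝ) ∈ TriD := ⟨ha.1.le, le_rfl, by simpa using ha.2⟩
      refine (hW _ hmem).tendsto.comp
        (f := fun r : ℝ => ((a, r) : ℝ × ℝ)) (tendsto_nhdsWithin_iff.2 ⟨?_, ?_⟩)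
      · exact tendsto_const_nhds.prodMk_nhds (tendsto_id.mono_left nhdsWithin_le_nhds)
      · filter_upwards [Ioo_mem_nhdsGT (show (0 : ℝ) < 1 - a by linarith [ha.2])] with r hr
        exact ⟨ha.1.le, hr.1.le, by have := hr.2; simp only; linarith⟩
  exact key.deriv

lemma intervalIntegrable_of_eq_rpow_neg_mul {x α : ℝ} (hα : α < 1) (hx : 0 ≤ x) {f G : ℝ → ℂ}
    (hG : ContinuousOn G (Icc 0 x))
    (hf : ∀ s ∈ Ioc 0 x, f s = ((s ^ (-α) : ℝ) : ℂ) * G s) :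
    IntervalIntegrable f volume 0 x := by
  have hr : IntervalIntegrable (fun s : ℝ => s ^ (-α)) volume 0 x :=
    intervalIntegral.intervalIntegrable_rpow' (by linarith)
  have h0 : IntervalIntegrable (fun s : ℝ => ((s ^ (-α) : ℝ) : ℂ)) volume 0 x :=
    ⟨hr.1.ofReal, hr.2.ofReal⟩
  refine (h0.mul_continuousOn (g := G) (by rwa [uIcc_of_le hx])).congr ?_
  rw [uIoc_of_le hx]
  intro s hs
  exact (hf s hs).symm

lemma tendsto_integral_of_eq_rpow_neg_mul {x y α τ₀ : ℝ} (hα : α < 1) (hx : 0 < x)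
    {f : ℝ → ℝ → ℂ} {G : ℝ × ℝ → ℂ} {τ : ℝ → ℝ}
    (hG : ContinuousOn G (Icc 0 x ×ˢ Icc 0 y))
    (hf : ∀ s ∈ Ioc 0 x, ∀ t ∈ Icc 0 y, f s t = ((s ^ (-α) : ℝ) : ℂ) * G (s, t))
    (hτ : ∀ᶠ ε in 𝓝[>] (0 : ℝ), τ ε ∈ Icc 0 y) (hτ₀ : τ₀ ∈ Icc 0 y)
    (hlim : Tendsto τ (𝓝[>] 0) (𝓝 τ₀)) :
    Tendsto (fun ε => ∫ s in ε..x, f s (τ ε)) (𝓝[>] 0) (𝓝 (∫ s in (0 : ℝ)..x, f s τ₀)) := by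
  obtain ⟨C, hC⟩ := (isCompact_Icc.prod isCompact_Icc).exists_bound_of_continuousOn hG
  have hslice : ∀ t ∈ Icc 0 y, IntervalIntegrable (fun s => f s t) volume 0 x := by
    intro t ht
    refine intervalIntegrable_of_eq_rpow_neg_mul hα hx.le (G := fun s => G (s, t)) ?_
      (fun s hs => hf s hs t ht)
    exact hG.comp (by fun_prop) (fun s hs => ⟨hs, ht⟩)
  have hmain : Tendsto (fun ε => ∫ s in (0 : ℝ)..x, (Ioi ε).indicator (fun s => f s (τ ε)) s)
      (𝓝[>] 0) (𝓝 (∫ s in (0 : ℝ)..x, f s τ₀)) := by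
    refine intervalIntegral.tendsto_integral_filter_of_dominated_convergence
      (fun s => s ^ (-α) * C) ?_ ?_ ?_ ?_
    · filter_upwards [hτ] with ε hε
      have := (hslice _ hε).aestronglyMeasurable_restrict_uIoc
      exact this.indicator measurableSet_Ioi
    · filter_upwards [hτ] with ε hε
      refine Eventually.of_forall fun s hs => ?_
      rw [uIoc_of_le hx.le] at hs
      refine (norm_indicator_le_norm_self _ _).trans ?_
      have hp : 0 ≤ s ^ (-α) := Real.rpow_nonneg hs.1.le _
      rw [hf s hs _ hε, norm_mul, Complex.norm_real, Real.norm_of_nonneg hp]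
      exact mul_le_mul_of_nonneg_left (hC _ ⟨⟨hs.1.le, hs.2⟩, hε⟩) hp
    · exact (intervalIntegral.intervalIntegrable_rpow' (by linarith)).mul_const C
    · refine Eventually.of_forall fun s hs => ?_
      rw [uIoc_of_le hx.le] at hs
      have hGs : Tendsto (fun ε => ((s ^ (-α) : ℝ) : ℂ) * G (s, τ ε)) (𝓝[>] 0)
          (𝓝 (f s τ₀)) := by
        rw [hf s hs _ hτ₀]
        refine tendsto_const_nhds.mul
          ((hG (s, τ₀) ⟨⟨hs.1.le, hs.2⟩, hτ₀⟩).tendsto.comp (tendsto_nhdsWithin_iff.2 ⟨?_, ?_⟩))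
        · exact tendsto_const_nhds.prodMk_nhds hlim
        · filter_upwards [hτ] with ε hε
          exact ⟨⟨hs.1.le, hs.2⟩, hε⟩
      refine hGs.congr' ?_
      filter_upwards [hτ, Ioo_mem_nhdsGT hs.1] with ε hε hεs
      rw [indicator_of_mem (show s ∈ Ioi ε from hεs.2), hf s hs _ hε]
  refine hmain.congr' ?_
  filter_upwards [Ioo_mem_nhdsGT hx] with ε hε
  rw [intervalIntegral.integral_of_le hx.le, intervalIntegral.integral_of_le hε.2.le,
    setIntegral_indicator measurableSet_Ioi, Ioc_inter_Ioi, max_eq_right hε.1.le]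

lemma sub_ofReal_ne_zero {k : ℂ} (hk : k ∉ seg01) {s : ℝ} (h0 : 0 ≤ s) (h1 : s ≤ 1) :
    k - (s : ℂ) ≠ 0 := fun h => hk ⟨s, ⟨h0, h1⟩, (sub_eq_zero.1 h).symm⟩

lemma div_mem_slitPlane {k : ℂ} (hk : k ∉ seg01) {p : ℝ × ℝ} (hp : p ∈ TriD) :
    (k - (1 - (p.2 : ℂ))) / (k - (p.1 : ℂ)) ∈ slitPlane := by
  obtain ⟨hs, ht, hst⟩ := hp
  rw [mem_slitPlane_iff_not_le_zero]
  intro hle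
  obtain ⟨r, hr0, hr⟩ : ∃ r : ℝ, 0 ≤ r ∧
      (k - (1 - (p.2 : ℂ))) / (k - (p.1 : ℂ)) = -(r : ℂ) := by
    rw [Complex.le_def] at hle
    refine ⟨-((k - (1 - (p.2 : ℂ))) / (k - (p.1 : ℂ))).re, by simpa using hle.1, ?_⟩
    apply Complex.ext
    · simp
    · simpa using hle.2
  rw [div_eq_iff (sub_ofReal_ne_zero hk hs (by linarith))] at hr
  have hr1 : (1 + (r : ℂ)) ≠ 0 := by
    have : (1 + r : ℝ) ≠ 0 := by positivity
    exact_mod_cast this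
  refine hk ⟨((1 - p.2) + r * p.1) / (1 + r), ⟨?_, ?_⟩, ?_⟩
  · have : 0 ≤ r * p.1 := mul_nonneg hr0 hs
    exact div_nonneg (by linarith) (by linarith)
  · rw [div_le_one (by linarith)]
    nlinarith
  · push_cast
    rw [div_eq_iff hr1]
    linear_combination -hr

lemma lam_ne_zero {k : ℂ} (hk : k ∉ seg01) {p : ℝ × ℝ} (hp : p ∈ TriD) :
    lam p.1 p.2 k ≠ 0 := by
  rw [lam, Ne, cpow_eq_zero_iff]
  exact fun h => slitPlane_ne_zero (div_mem_slitPlane hk hp) h.1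

lemma lam_sq (s t : ℝ) (k : ℂ) : lam s t k ^ 2 = (k - (1 - (t : ℂ))) / (k - (s : ℂ)) := by
  rw [lam, one_div]
  exact_mod_cast cpow_nat_inv_pow _ two_ne_zero

lemma differentiableAt_lam {k : ℂ} (hk : k ∉ seg01) {p : ℝ × ℝ} (hp : p ∈ TriD) :
    DifferentiableAt ℝ (fun q : ℝ × ℝ => lam q.1 q.2 k) p := by
  have h1 : DifferentiableAt ℝ (fun q : ℝ × ℝ => (q.1 : ℂ)) p :=
    (ofRealCLM.comp (ContinuousLinearMap.fst ℝ ℝ ℝ)).differentiableAt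
  have h2 : DifferentiableAt ℝ (fun q : ℝ × ℝ => (q.2 : ℂ)) p :=
    (ofRealCLM.comp (ContinuousLinearMap.snd ℝ ℝ ℝ)).differentiableAt
  have h3 : DifferentiableAt ℝ
      (fun q : ℝ × ℝ => (k - (1 - (q.2 : ℂ))) / (k - (q.1 : ℂ))) p := by
    simp only [div_eq_mul_inv]
    exact ((h2.const_sub 1).const_sub k).fun_mul ((h1.const_sub k).fun_inv
      (sub_ofReal_ne_zero hk hp.1 (by linarith [hp.2.1, hp.2.2])))
  have h4 : DifferentiableAt ℝ (fun z : ℂ => z ^ (1 / 2 : ℂ))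
      ((k - (1 - (p.2 : ℂ))) / (k - (p.1 : ℂ))) :=
    ((differentiableAt_id (𝕜 := ℂ)).cpow_const (div_mem_slitPlane hk hp)).restrictScalars ℝ
  exact h4.comp p h3

lemma continuousOn_lam {k : ℂ} (hk : k ∉ seg01) :
    ContinuousOn (fun q : ℝ × ℝ => lam q.1 q.2 k) TriD :=
  fun _ hp => (differentiableAt_lam hk hp).continuousAt.continuousWithinAt

lemma fderiv_lam_fst {k : ℂ} (hk : k ∉ seg01) {p : ℝ × ℝ} (hp : p ∈ TriD) :
    fderiv ℝ (fun q : ℝ × ℝ => lam q.1 q.2 k) p (1, 0) =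
      lam p.1 p.2 k / (2 * (k - (p.1 : ℂ))) := by
  have hne := lam_ne_zero hk hp
  have hk1 := sub_ofReal_ne_zero hk hp.1 (by linarith [hp.2.1, hp.2.2])
  have hline : HasDerivAt (fun a : ℝ => (a, p.2)) ((1, 0) : ℝ × ℝ) p.1 :=
    (hasDerivAt_id p.1).prodMk (hasDerivAt_const p.1 p.2)
  have h1 := ((differentiableAt_lam hk hp).hasFDerivAt.comp_hasDerivAt p.1 hline).fun_pow 2
  have h2 : HasDerivAt (fun a : ℝ => (k - (1 - (p.2 : ℂ))) / (k - (a : ℂ))) _ p.1 :=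
    (hasDerivAt_const p.1 (k - (1 - (p.2 : ℂ)))).fun_div
      ((hasDerivAt_id p.1).ofReal_comp.const_sub k) hk1
  have h3 := h1.unique (h2.congr_of_eventuallyEq
    (Eventually.of_forall fun a => lam_sq a p.2 k))
  have hsq := lam_sq p.1 p.2 k
  simp only [Function.comp_apply] at h3
  rw [eq_div_iff hk1] at hsq
  rw [← hsq] at h3
  field_simp at h3 ⊢
  simp at h3
  refine mul_left_cancel₀ hne ?_
  linear_combination h3

lemma fderiv_lam_snd {k : ℂ} (hk : k ∉ seg01) {p : ℝ × ℝ} (hp : p ∈ TriD) :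
    fderiv ℝ (fun q : ℝ × ℝ => lam q.1 q.2 k) p (0, 1) =
      1 / (2 * lam p.1 p.2 k * (k - (p.1 : ℂ))) := by
  have hne := lam_ne_zero hk hp
  have hk1 := sub_ofReal_ne_zero hk hp.1 (by linarith [hp.2.1, hp.2.2])
  have hline : HasDerivAt (fun b : ℝ => (p.1, b)) ((0, 1) : ℝ × ℝ) p.2 :=
    (hasDerivAt_const p.2 p.1).prodMk (hasDerivAt_id p.2)
  have h1 := ((differentiableAt_lam hk hp).hasFDerivAt.comp_hasDerivAt p.2 hline).fun_pow 2
  have h2 : HasDerivAt (fun b : ℝ => (k - (1 - (b : ℂ))) / (k - (p.1 : ℂ))) _ p.2 :=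
    (((hasDerivAt_id p.2).ofReal_comp.const_sub 1).const_sub k).div_const (k - (p.1 : ℂ))
  have h3 := h1.unique (h2.congr_of_eventuallyEq
    (Eventually.of_forall fun b => lam_sq p.1 b k))
  simp only [Function.comp_apply] at h3
  field_simp at h3 ⊢
  simp at h3
  linear_combination h3

lemma hasFDerivAt_pdxR_pdyR {V : ℝ → ℝ → ℝ} {p : ℝ × ℝ}
    (hV : ContDiffAt ℝ 2 (fun q : ℝ × ℝ => V q.1 q.2) p) :
    ∃ A B : ℝ × ℝ →L[ℝ] ℝ,
      HasFDerivAt (fun q : ℝ × ℝ => pdxR V q.1 q.2) A p ∧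
      HasFDerivAt (fun q : ℝ × ℝ => pdyR V q.1 q.2) B p ∧
      A (0, 1) = pdxyR V p.1 p.2 ∧ B (1, 0) = pdxyR V p.1 p.2 := by
  set F : ℝ × ℝ → ℝ := fun q => V q.1 q.2
  have hev : ∀ᶠ q in 𝓝 p, DifferentiableAt ℝ F q := by
    filter_upwards [hV.eventually (by simp)] with q hq
    exact hq.differentiableAt (by simp)
  have hx : ∀ᶠ q in 𝓝 p, pdxR V q.1 q.2 = fderiv ℝ F q (1, 0) := by
    filter_upwards [hev] with q hq
    have hline : HasDerivAt (fun a : ℝ => (a, q.2)) ((1, 0) : ℝ × ℝ) q.1 :=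
      (hasDerivAt_id q.1).prodMk (hasDerivAt_const q.1 q.2)
    exact (hq.hasFDerivAt.comp_hasDerivAt q.1 hline).deriv
  have hy : ∀ᶠ q in 𝓝 p, pdyR V q.1 q.2 = fderiv ℝ F q (0, 1) := by
    filter_upwards [hev] with q hq
    have hline : HasDerivAt (fun b : ℝ => (q.1, b)) ((0, 1) : ℝ × ℝ) q.2 :=
      (hasDerivAt_const q.2 q.1).prodMk (hasDerivAt_id q.2)
    exact (hq.hasFDerivAt.comp_hasDerivAt q.2 hline).deriv
  have h2 : HasFDerivAt (fderiv ℝ F) (fderiv ℝ (fderiv ℝ F) p) p :=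
    ((hV.fderiv_right (m := 1) (by norm_num)).differentiableAt (by simp)).hasFDerivAt
  have hsymm : IsSymmSndFDerivAt ℝ F p := hV.isSymmSndFDerivAt (by simp)
  have hA := (h2.clm_apply (hasFDerivAt_const ((1, 0) : ℝ × ℝ) p)).congr_of_eventuallyEq hx
  have hB := (h2.clm_apply (hasFDerivAt_const ((0, 1) : ℝ × ℝ) p)).congr_of_eventuallyEq hy
  have hline : HasDerivAt (fun a : ℝ => (a, p.2)) ((1, 0) : ℝ × ℝ) p.1 :=
    (hasDerivAt_id p.1).prodMk (hasDerivAt_const p.1 p.2)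
  have hmix := (hB.comp_hasDerivAt p.1 hline).deriv
  refine ⟨_, _, hA, hB, ?_, hmix.symm⟩
  refine Eq.trans ?_ hmix.symm
  simpa using hsymm (0, 1) (1, 0)

/-- The one-form `λ V_x dx + λ⁻¹ V_y dy` is closed in the interior of the triangle. -/
lemma eulerDarboux_closed {V : ℝ → ℝ → ℝ} {k : ℂ} (hk : k ∉ seg01) {p : ℝ × ℝ} (hp : p ∈ TriD)
    (hV : ContDiffAt ℝ 2 (fun q : ℝ × ℝ => V q.1 q.2) p) (hED : EulerDarbouxAt V p.1 p.2) :
    ∃ f' g' : ℝ × ℝ →L[ℝ] ℂ,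
      HasFDerivAt (fun q : ℝ × ℝ => (lam q.1 q.2 k)⁻¹ * (pdyR V q.1 q.2 : ℂ)) f' p ∧
      HasFDerivAt (fun q : ℝ × ℝ => lam q.1 q.2 k * (pdxR V q.1 q.2 : ℂ)) g' p ∧
      f' (1, 0) = g' (0, 1) := by
  obtain ⟨A, B, hA, hB, hA1, hB1⟩ := hasFDerivAt_pdxR_pdyR hV
  have hL := (differentiableAt_lam hk hp).hasFDerivAt
  have hne := lam_ne_zero hk hp
  have hk1 := sub_ofReal_ne_zero hk hp.1 (by linarith [hp.2.1, hp.2.2])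
  have hA' : HasFDerivAt (fun q : ℝ × ℝ => (pdxR V q.1 q.2 : ℂ)) (ofRealCLM.comp A) p :=
    ofRealCLM.hasFDerivAt.comp p hA
  have hB' : HasFDerivAt (fun q : ℝ × ℝ => (pdyR V q.1 q.2 : ℂ)) (ofRealCLM.comp B) p :=
    ofRealCLM.hasFDerivAt.comp p hB
  have hLinv : HasFDerivAt (fun q : ℝ × ℝ => (lam q.1 q.2 k)⁻¹) _ p :=
    HasFDerivAt.comp p ((hasDerivAt_inv hne).hasFDerivAt.restrictScalars ℝ) hL
  refine ⟨_, _, hLinv.mul hB', hL.mul hA', ?_⟩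
  have hpos : (1 - (p.1 : ℂ) - (p.2 : ℂ)) ≠ 0 := by
    have : (1 - p.1 - p.2 : ℝ) ≠ 0 := by linarith [hp.2.2]
    exact_mod_cast this
  have hEDc : (pdxyR V p.1 p.2 : ℂ) * (2 * (1 - (p.1 : ℂ) - (p.2 : ℂ))) =
      (pdxR V p.1 p.2 : ℂ) + (pdyR V p.1 p.2 : ℂ) := by
    have h := sub_eq_zero.1 hED
    rw [h]
    push_cast
    field_simp
  have hsq := lam_sq p.1 p.2 k
  rw [eq_div_iff hk1] at hsq
  simp [hA1, hB1, fderiv_lam_fst hk hp, fderiv_lam_snd hk hp]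
  field_simp
  linear_combination (pdxyR V p.1 p.2 : ℂ) * (-2) * hsq + hEDc

lemma eulerDarboux_rectangle {V : ℝ → ℝ → ℝ} {k : ℂ} (hk : k ∉ seg01)
    (hV : ContDiffOn ℝ 2 (fun q : ℝ × ℝ => V q.1 q.2) (interior TriD))
    (hED : ∀ p ∈ interior TriD, EulerDarbouxAt V p.1 p.2)
    {a b x y : ℝ} (ha : 0 < a) (hb : 0 < b) (hax : a ≤ x) (hby : b ≤ y) (hxy : x + y < 1) :
    (∫ s in a..x, lam s b k * (pdxR V s b : ℂ)) +
        (∫ t in b..y, (lam x t k)⁻¹ * (pdyR V x t : ℂ)) =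
      (∫ t in b..y, (lam a t k)⁻¹ * (pdyR V a t : ℂ)) +
        (∫ s in a..x, lam s y k * (pdxR V s y : ℂ)) := by
  have hsub : Icc a x ×ˢ Icc b y ⊆ interior TriD := fun p hp =>
    mem_interior_triD (ha.trans_le hp.1.1) (hb.trans_le hp.2.1)
      (by linarith [hp.1.2, hp.2.2])
  have hclosed : ∀ p ∈ Icc a x ×ˢ Icc b y, _ := fun p hp =>
    eulerDarboux_closed hk (interior_subset (hsub hp))
      (hV.contDiffAt (isOpen_interior.mem_nhds (hsub hp))) (hED p (hsub hp))
  choose! f' g' hf hg hfg using hclosed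
  have hioo : Ioo (min a x) (max a x) ×ˢ Ioo (min b y) (max b y) \ ∅ ⊆ Icc a x ×ˢ Icc b y := by
    rw [min_eq_left hax, max_eq_right hax, min_eq_left hby, max_eq_right hby, sdiff_empty]
    exact prod_mono Ioo_subset_Icc_self Ioo_subset_Icc_self
  have hu : uIcc a x ×ˢ uIcc b y = Icc a x ×ˢ Icc b y := by rw [uIcc_of_le hax, uIcc_of_le hby]
  have hzero : ∀ p ∈ Icc a x ×ˢ Icc b y, f' p (1, 0) + (-g' p) (0, 1) = 0 := fun p hp => by
    simp [hfg p hp]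
  have hdiv := integral2_divergence_prod_of_hasFDerivAt_off_countable
    (fun q : ℝ × ℝ => (lam q.1 q.2 k)⁻¹ * (pdyR V q.1 q.2 : ℂ))
    (fun q : ℝ × ℝ => -(lam q.1 q.2 k * (pdxR V q.1 q.2 : ℂ)))
    f' (fun p => -g' p) a b x y ∅ countable_empty
    (by rw [hu]; exact fun p hp => (hf p hp).continuousAt.continuousWithinAt)
    (by rw [hu]; exact fun p hp => (hg p hp).neg.continuousAt.continuousWithinAt)
    (fun p hp => hf p (hioo hp)) (fun p hp => (hg p (hioo hp)).fun_neg)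
    (by
      rw [hu]
      exact integrableOn_zero.congr_fun (fun p hp => (hzero p hp).symm)
        (measurableSet_Icc.prod measurableSet_Icc))
  have hleft : (∫ s in a..x, ∫ t in b..y, f' (s, t) (1, 0) + (-g' (s, t)) (0, 1)) = 0 := by
    refine intervalIntegral.integral_zero_ae (Eventually.of_forall fun s hs => ?_)
    refine intervalIntegral.integral_zero_ae (Eventually.of_forall fun t ht => ?_)
    rw [uIoc_of_le hax] at hs
    rw [uIoc_of_le hby] at ht
    exact hzero (s, t) ⟨Ioc_subset_Icc_self hs, Ioc_subset_Icc_self ht⟩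
  rw [hleft] at hdiv
  simp only [intervalIntegral.integral_neg] at hdiv
  linear_combination -hdiv

/-- Path independence of the one-form W = λ V_x dx + λ⁻¹ V_y dy for a
solution of the Euler–Darboux Goursat problem: the integrals along the two boundary
paths from (0,0) to (x,y) agree, and all four integrals converge absolutely. -/
theorem eulerDarboux_path_independence
    (n : ℕ) (hn : 2 ≤ n) (α : ℝ) (hα : α ∈ Ico (0:ℝ) 1)
    (V0 V1 : ℝ → ℝ) (hd0 : EDData n α V0) (hd1 : EDData n α V1)
    (V : ℝ → ℝ → ℝ) (hV : EDSolution n V V0 V1)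
    (x y : ℝ) (hxy : (x, y) ∈ TriD) (k : ℂ) (hk : k ∉ seg01) :
    IntervalIntegrable (fun x' => lam x' 0 k * (pdxR V x' 0 : ℂ)) volume 0 x ∧
    IntervalIntegrable (fun y' => (lam x y' k)⁻¹ * (pdyR V x y' : ℂ)) volume 0 y ∧
    IntervalIntegrable (fun y' => (lam 0 y' k)⁻¹ * (pdyR V 0 y' : ℂ)) volume 0 y ∧
    IntervalIntegrable (fun x' => lam x' y k * (pdxR V x' y : ℂ)) volume 0 x ∧
    (∫ x' in (0:ℝ)..x, lam x' 0 k * (pdxR V x' 0 : ℂ)) +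
        (∫ y' in (0:ℝ)..y, (lam x y' k)⁻¹ * (pdyR V x y' : ℂ)) =
      (∫ y' in (0:ℝ)..y, (lam 0 y' k)⁻¹ * (pdyR V 0 y' : ℂ)) +
        (∫ x' in (0:ℝ)..x, lam x' y k * (pdxR V x' y : ℂ)) := by
  obtain ⟨β, hβ, hc, hCD, hED, ⟨g₁, hg₁, hg₁V⟩, ⟨g₂, hg₂, hg₂V⟩, -, -, -⟩ := hV
  obtain ⟨hx, hy, hxy1⟩ : 0 ≤ x ∧ 0 ≤ y ∧ x + y < 1 := hxy
  have hCD2 := hCD.of_le (show (2 : WithTop ℕ∞) ≤ n by exact_mod_cast hn)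
  have hdiff : ∀ s t, 0 < s → 0 < t → s + t < 1 →
      DifferentiableAt ℝ (fun q : ℝ × ℝ => V q.1 q.2) (s, t) := fun s t hs ht hst =>
    (hCD2.contDiffAt (isOpen_interior.mem_nhds (mem_interior_triD hs ht hst))).differentiableAt
      (by simp)
  have hswap : MapsTo Prod.swap TriD TriD := fun p hp =>
    ⟨hp.2.1, hp.1, by have := hp.2.2; simp only [Prod.fst_swap, Prod.snd_swap]; linarith⟩
  have hX : ∀ s t, 0 < s → 0 ≤ t → s + t < 1 → pdxR V s t = s ^ (-β) * g₁ (s, t) :=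
    fun s t => pdxR_eq_rpow_neg_mul hc
      (fun s t hs ht hst => (hdiff s t hs ht hst).comp (f := fun a : ℝ => (a, t)) s
        (differentiableAt_id.prodMk (differentiableAt_const t)))
      hg₁ (fun s t hs ht hst => hg₁V (s, t) (mem_interior_triD hs ht hst))
  have hY : ∀ s t, 0 ≤ s → 0 < t → s + t < 1 → pdyR V s t = t ^ (-β) * g₂ (s, t) :=
    fun s t hs ht hst => pdxR_eq_rpow_neg_mul (W := fun a b => V b a) (g := g₂ ∘ Prod.swap)
      (hc.comp continuous_swap.continuousOn hswap)
      (fun t s ht hs hst => (hdiff s t hs ht (by linarith)).comp (f := fun a : ℝ => (s, a)) t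
        ((differentiableAt_const s).prodMk differentiableAt_id))
      (hg₂.comp continuous_swap.continuousOn hswap)
      (fun t s ht hs hst => hg₂V (s, t) (mem_interior_triD hs ht (by linarith)))
      ht hs (by linarith)
  have hrect : Icc 0 x ×ˢ Icc 0 y ⊆ TriD := fun p hp =>
    ⟨hp.1.1, hp.2.1, by linarith [hp.1.2, hp.2.2]⟩
  have hrect' : MapsTo Prod.swap (Icc 0 y ×ˢ Icc 0 x) TriD := fun p hp =>
    ⟨hp.2.1, hp.1.1, by
      have h1 := hp.2.2
      have h2 := hp.1.2
      simp only [Prod.fst_swap, Prod.snd_swap]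
      linarith⟩
  have hG₁ : ContinuousOn (fun p : ℝ × ℝ => lam p.1 p.2 k * (g₁ p : ℂ)) (Icc 0 x ×ˢ Icc 0 y) :=
    ((continuousOn_lam hk).mul (continuous_ofReal.comp_continuousOn hg₁)).mono hrect
  have hG₂ : ContinuousOn (fun p : ℝ × ℝ => (lam p.2 p.1 k)⁻¹ * (g₂ p.swap : ℂ))
      (Icc 0 y ×ˢ Icc 0 x) := by
    have hlam : ContinuousOn (fun p : ℝ × ℝ => lam p.2 p.1 k) (Icc 0 y ×ˢ Icc 0 x) :=
      (continuousOn_lam hk).comp (f := Prod.swap) continuous_swap.continuousOn hrect'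
    have hg : ContinuousOn (fun p : ℝ × ℝ => g₂ p.swap) (Icc 0 y ×ˢ Icc 0 x) :=
      hg₂.comp continuous_swap.continuousOn hrect'
    have hne : ∀ p ∈ Icc 0 y ×ˢ Icc 0 x, lam p.2 p.1 k ≠ 0 := fun p hp =>
      lam_ne_zero hk (hrect' hp)
    exact (hlam.inv₀ hne).mul (continuous_ofReal.comp_continuousOn hg)
  have hf₁ : ∀ s ∈ Ioc 0 x, ∀ t ∈ Icc 0 y, lam s t k * (pdxR V s t : ℂ) =
      ((s ^ (-β) : ℝ) : ℂ) * (lam s t k * (g₁ (s, t) : ℂ)) := by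
    intro s hs t ht
    rw [hX s t hs.1 ht.1 (by linarith [hs.2, ht.2])]
    push_cast
    ring
  have hf₂ : ∀ t ∈ Ioc 0 y, ∀ s ∈ Icc 0 x, (lam s t k)⁻¹ * (pdyR V s t : ℂ) =
      ((t ^ (-β) : ℝ) : ℂ) * ((lam s t k)⁻¹ * (g₂ (s, t) : ℂ)) := by
    intro t ht s hs
    rw [hY s t hs.1 ht.1 (by linarith [hs.2, ht.2])]
    push_cast
    ring
  have hI₁ : ∀ t ∈ Icc 0 y,
      IntervalIntegrable (fun s => lam s t k * (pdxR V s t : ℂ)) volume 0 x := fun t ht =>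
    intervalIntegrable_of_eq_rpow_neg_mul hβ.2 hx
      (hG₁.comp (f := fun s : ℝ => (s, t)) (by fun_prop) (fun s hs => ⟨hs, ht⟩))
      (fun s hs => hf₁ s hs t ht)
  have hI₂ : ∀ s ∈ Icc 0 x,
      IntervalIntegrable (fun t => (lam s t k)⁻¹ * (pdyR V s t : ℂ)) volume 0 y := fun s hs =>
    intervalIntegrable_of_eq_rpow_neg_mul hβ.2 hy
      (hG₂.comp (f := fun t : ℝ => (t, s)) (by fun_prop) (fun t ht => ⟨ht, hs⟩))
      (fun t ht => hf₂ t ht s hs)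
  refine ⟨hI₁ 0 ⟨le_rfl, hy⟩, hI₂ x ⟨hx, le_rfl⟩, hI₂ 0 ⟨le_rfl, hx⟩, hI₁ y ⟨hy, le_rfl⟩, ?_⟩
  rcases hx.eq_or_lt with hx0 | hx
  · simp [← hx0]
  rcases hy.eq_or_lt with hy0 | hy
  · simp [← hy0]
  have hid : Tendsto (fun ε : ℝ => ε) (𝓝[>] 0) (𝓝 0) := tendsto_id.mono_left nhdsWithin_le_nhds
  have hsmall : ∀ z : ℝ, 0 < z → ∀ᶠ ε in 𝓝[>] (0 : ℝ), ε ∈ Icc 0 z := fun z hz =>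
    mem_of_superset (Ioo_mem_nhdsGT hz) Ioo_subset_Icc_self
  have hlim₁ : ∀ (τ : ℝ → ℝ) (τ₀ : ℝ), (∀ᶠ ε in 𝓝[>] (0 : ℝ), τ ε ∈ Icc 0 y) → τ₀ ∈ Icc 0 y →
      Tendsto τ (𝓝[>] 0) (𝓝 τ₀) →
      Tendsto (fun ε => ∫ s in ε..x, lam s (τ ε) k * (pdxR V s (τ ε) : ℂ)) (𝓝[>] 0)
        (𝓝 (∫ s in (0 : ℝ)..x, lam s τ₀ k * (pdxR V s τ₀ : ℂ))) := fun τ τ₀ =>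
    tendsto_integral_of_eq_rpow_neg_mul
      (f := fun s t => lam s t k * (pdxR V s t : ℂ)) hβ.2 hx hG₁ hf₁
  have hlim₂ : ∀ (τ : ℝ → ℝ) (τ₀ : ℝ), (∀ᶠ ε in 𝓝[>] (0 : ℝ), τ ε ∈ Icc 0 x) → τ₀ ∈ Icc 0 x →
      Tendsto τ (𝓝[>] 0) (𝓝 τ₀) →
      Tendsto (fun ε => ∫ t in ε..y, (lam (τ ε) t k)⁻¹ * (pdyR V (τ ε) t : ℂ)) (𝓝[>] 0)
        (𝓝 (∫ t in (0 : ℝ)..y, (lam τ₀ t k)⁻¹ * (pdyR V τ₀ t : ℂ))) := fun τ τ₀ =>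
    tendsto_integral_of_eq_rpow_neg_mul
      (f := fun t s => (lam s t k)⁻¹ * (pdyR V s t : ℂ)) hβ.2 hy hG₂ hf₂
  have hL := (hlim₁ _ _ (hsmall y hy) ⟨le_rfl, hy.le⟩ hid).add
    (hlim₂ (fun _ => x) x (Eventually.of_forall fun _ => ⟨hx.le, le_rfl⟩) ⟨hx.le, le_rfl⟩
      tendsto_const_nhds)
  have hR := (hlim₂ _ _ (hsmall x hx) ⟨le_rfl, hx.le⟩ hid).add
    (hlim₁ (fun _ => y) y (Eventually.of_forall fun _ => ⟨hy.le, le_rfl⟩) ⟨hy.le, le_rfl⟩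
      tendsto_const_nhds)
  refine tendsto_nhds_unique_of_eventuallyEq hL hR ?_
  filter_upwards [self_mem_nhdsWithin, hsmall x hx, hsmall y hy] with ε hε hεx hεy
  exact eulerDarboux_rectangle hk hCD2 hED hε hε hεx.2 hεy.2 hxy1
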